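/- There exist universal constants c, C > 0 with the following property. Let ε, δ ∈ (0,1), let x₁, …, xₙ ∈ ℝ^d be unit vectors, let T = conv{x₁, …, xₙ}, and let m ≥ c·ε⁻²·log(n·log(2/ε)/δ). Let Π ∈ ℝ^{m×d} be a random matrix whose entries are i.i.d. Gaussian with mean 0 and variance 1/m. Then with probability at least 1 − δ/n, for every t ∈ T one has |‖Π t‖₂ − ‖t‖₂| ≤ C·ε. -/

import Mathlib

open MeasureTheory ProbabilityTheory
open scoped NNReal


lemma row_law {d : ℕ} (v : Fin d → ℝ) (V : ℝ≥0) :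
    (Measure.pi fun _ : Fin d => gaussianReal 0 V).map (fun ω => ∑ j, ω j * v j)
      = gaussianReal 0 (V * (∑ j, v j ^ 2).toNNReal) := by
  apply Measure.ext_of_charFun
  ext t
  rw [charFun_apply_real, integral_map (Measurable.aemeasurable (by fun_prop)) (by fun_prop), charFun_gaussianReal]
  have h : ∀ ω : Fin d → ℝ, Complex.exp (t * ((∑ j, ω j * v j : ℝ) : ℂ) * Complex.I)
      = ∏ j, Complex.exp (((t * v j : ℝ) : ℂ) * (ω j : ℂ) * Complex.I) := by
    intro ω
    rw [← Complex.exp_sum]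
    congr 1
    push_cast
    rw [Finset.mul_sum, Finset.sum_mul]
    refine Finset.sum_congr rfl fun j _ => by ring
  simp_rw [h]
  rw [integral_fintype_prod_eq_prod (f := fun (j : Fin d) (x : ℝ) =>
    Complex.exp (((t * v j : ℝ) : ℂ) * (x : ℂ) * Complex.I))]
  simp_rw [← charFun_apply_real, charFun_gaussianReal]
  rw [← Complex.exp_sum]
  congr 1
  have : (0:ℝ) ≤ ∑ j, v j ^ 2 := Finset.sum_nonneg fun j _ => sq_nonneg _
  rw [NNReal.coe_mul, Real.coe_toNNReal _ this]
  push_cast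
  simp only [mul_zero, zero_mul, zero_sub]
  rw [Finset.mul_sum, Finset.sum_mul, Finset.sum_div, Finset.sum_neg_distrib]
  congr 1
  refine Finset.sum_congr rfl fun j _ => by ring

lemma gauss_sq_mgf (V : ℝ≥0) (hV : V ≠ 0) (a : ℝ) (ha : |a * V| ≤ 1 / 4) :
    0 < ∫ x, Real.exp (a * x ^ 2) ∂(gaussianReal 0 V) ∧
    ∫ x, Real.exp (a * x ^ 2) ∂(gaussianReal 0 V) ≤ Real.exp (a * V + 4 * (a * V) ^ 2) := by
  have hV0 : (0:ℝ) < V := by positivity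
  obtain ⟨h1, h2⟩ := abs_le.1 ha
  have hpos : 0 < 1 - 2 * (a * V) := by linarith
  have key : ∫ x, Real.exp (a * x ^ 2) ∂(gaussianReal 0 V) = (√(1 - 2 * (a * V)))⁻¹ := by
    rw [integral_gaussianReal_eq_integral_smul hV]
    have : ∀ x : ℝ, gaussianPDFReal 0 V x • Real.exp (a * x ^ 2)
        = (√(2 * Real.pi * V))⁻¹ * Real.exp (-((1 - 2 * (a * V)) / (2 * V)) * x ^ 2) := by
      intro x
      rw [gaussianPDFReal, smul_eq_mul, mul_assoc, ← Real.exp_add]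
      congr 2
      field_simp
      ring
    simp_rw [this]
    rw [integral_const_mul, integral_gaussian, ← Real.sqrt_inv, ← Real.sqrt_mul (by positivity),
      ← Real.sqrt_inv]
    congr 1
    have := Real.pi_pos
    field_simp
  rw [key]
  refine ⟨by positivity, ?_⟩
  have hl := Real.abs_log_sub_add_sum_range_le (x := 2 * (a * V)) (by rw [abs_lt]; constructor <;> linarith) 1
  simp only [Finset.range_one, Finset.sum_singleton, Nat.cast_zero, zero_add, pow_one, div_one] at hl
  have hu : |2 * (a * V)| ≤ 1 / 2 := by rw [abs_le]; constructor <;> linarith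
  have hb : |2 * (a * V)| ^ (1 + 1) / (1 - |2 * (a * V)|) ≤ 2 * (2 * (a * V)) ^ 2 := by
    rw [div_le_iff₀ (by linarith), show 1 + 1 = 2 from rfl, sq_abs]
    nlinarith [sq_nonneg (2 * (a * V))]
  have hl2 := (abs_le.1 (hl.trans hb)).1
  rw [← Real.exp_log (by positivity : 0 < (√(1 - 2 * (a * V)))⁻¹), Real.log_inv, Real.log_sqrt hpos.le]
  apply Real.exp_le_exp.2
  nlinarith

/-- squared norm of the image -/
lemma norm_sq_image {m d : ℕ} (ω : Fin m → Fin d → ℝ) (v : EuclideanSpace ℝ (Fin d)) :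
    ‖Matrix.toEuclideanLin (Matrix.of ω) v‖ ^ 2 = ∑ i, (∑ j, ω i j * v j) ^ 2 := by
  rw [EuclideanSpace.norm_sq_eq]
  refine Finset.sum_congr rfl fun i _ => ?_
  simp [Matrix.toLpLin_apply, Matrix.mulVec, dotProduct]

noncomputable abbrev gm (m d : ℕ) : Measure (Fin m → Fin d → ℝ) :=
  Measure.pi fun _ : Fin m => Measure.pi fun _ : Fin d => gaussianReal 0 (1 / m : ℝ≥0)

lemma mgf_bound {m d : ℕ} (hm : m ≠ 0) (v : EuclideanSpace ℝ (Fin d)) (hv : v ≠ 0) (η : ℝ)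
    (hη : |η| ≤ 1 / 4) :
    0 < mgf (fun ω => ‖Matrix.toEuclideanLin (Matrix.of ω) v‖ ^ 2) (gm m d) (η * m / ‖v‖ ^ 2) ∧
    mgf (fun ω => ‖Matrix.toEuclideanLin (Matrix.of ω) v‖ ^ 2) (gm m d) (η * m / ‖v‖ ^ 2)
      ≤ Real.exp (m * (η + 4 * η ^ 2)) := by
  have hv' : 0 < ‖v‖ := norm_pos_iff.2 hv
  have hm' : (0:ℝ) < m := by positivity
  set a := η * m / ‖v‖ ^ 2 with ha
  have h1 : mgf (fun ω => ‖Matrix.toEuclideanLin (Matrix.of ω) v‖ ^ 2) (gm m d) a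
      = (∫ x, Real.exp (a * x ^ 2) ∂(gaussianReal 0 ((1 / m : ℝ≥0) * (∑ j, v j ^ 2).toNNReal))) ^ m := by
    rw [mgf]
    have : ∀ ω : Fin m → Fin d → ℝ, Real.exp (a * ‖Matrix.toEuclideanLin (Matrix.of ω) v‖ ^ 2)
        = ∏ i, Real.exp (a * (∑ j, ω i j * v j) ^ 2) := by
      intro ω
      rw [norm_sq_image, ← Real.exp_sum, Finset.mul_sum]
    simp_rw [this]
    rw [integral_fintype_prod_eq_prod (f := fun (i : Fin m) (x : Fin d → ℝ) =>
      Real.exp (a * (∑ j, x j * v j) ^ 2)), ← row_law,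
      integral_map (Measurable.aemeasurable (by fun_prop)) (by fun_prop)]
    simp
  have hs : ∑ j, v j ^ 2 = ‖v‖ ^ 2 := by
    rw [EuclideanSpace.norm_sq_eq]; simp
  have hV : (((1 / m : ℝ≥0) * (∑ j, v j ^ 2).toNNReal : ℝ≥0) : ℝ) = ‖v‖ ^ 2 / m := by
    rw [hs, NNReal.coe_mul, Real.coe_toNNReal _ (by positivity)]
    push_cast; ring
  have haV : a * (((1 / m : ℝ≥0) * (∑ j, v j ^ 2).toNNReal : ℝ≥0) : ℝ) = η := by
    rw [hV, ha]; field_simp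
  have := gauss_sq_mgf ((1 / m : ℝ≥0) * (∑ j, v j ^ 2).toNNReal)
    (by
      intro h
      rw [h, NNReal.coe_zero] at hV
      have : 0 < ‖v‖ ^ 2 / m := by positivity
      linarith) a (by rw [haV]; exact hη)
  rw [haV] at this
  rw [h1]
  refine ⟨pow_pos this.1 _, ?_⟩
  rw [Real.exp_nat_mul]
  exact pow_le_pow_left₀ this.1.le this.2 _

lemma upper_tail {m d : ℕ} (hm : m ≠ 0) (v : EuclideanSpace ℝ (Fin d)) (hv : v ≠ 0) (η τ : ℝ)
    (h0 : 0 ≤ η) (hη : η ≤ 1 / 4) :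
    (gm m d).real {ω | (1 + τ) * ‖v‖ ^ 2 ≤ ‖Matrix.toEuclideanLin (Matrix.of ω) v‖ ^ 2}
      ≤ Real.exp (m * (4 * η ^ 2 - η * τ)) := by
  have hv' : 0 < ‖v‖ := norm_pos_iff.2 hv
  obtain ⟨h1, h2⟩ := mgf_bound hm v hv η (by rw [abs_of_nonneg h0]; exact hη)
  have := measure_ge_le_exp_mul_mgf (μ := gm m d) (t := η * m / ‖v‖ ^ 2)
    (X := fun ω => ‖Matrix.toEuclideanLin (Matrix.of ω) v‖ ^ 2)
    ((1 + τ) * ‖v‖ ^ 2) (by positivity) (by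
      by_contra h
      rw [mgf, integral_undef h] at h1
      exact lt_irrefl _ h1)
  refine this.trans ((mul_le_mul_of_nonneg_left h2 (Real.exp_pos _).le).trans ?_)
  rw [← Real.exp_add]
  apply Real.exp_le_exp.2
  apply le_of_eq
  field_simp
  ring

lemma lower_tail {m d : ℕ} (hm : m ≠ 0) (v : EuclideanSpace ℝ (Fin d)) (hv : v ≠ 0) (η τ : ℝ)
    (h0 : 0 ≤ η) (hη : η ≤ 1 / 4) :
    (gm m d).real {ω | ‖Matrix.toEuclideanLin (Matrix.of ω) v‖ ^ 2 ≤ (1 - τ) * ‖v‖ ^ 2}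
      ≤ Real.exp (m * (4 * η ^ 2 - η * τ)) := by
  have hv' : 0 < ‖v‖ := norm_pos_iff.2 hv
  obtain ⟨h1, h2⟩ := mgf_bound hm v hv (-η) (by rw [abs_neg, abs_of_nonneg h0]; exact hη)
  have := measure_le_le_exp_mul_mgf (μ := gm m d) (t := -η * m / ‖v‖ ^ 2)
    (X := fun ω => ‖Matrix.toEuclideanLin (Matrix.of ω) v‖ ^ 2)
    ((1 - τ) * ‖v‖ ^ 2) (by
      rw [neg_mul, neg_div]; exact neg_nonpos.2 (by positivity)) (by
      by_contra h
      rw [mgf, integral_undef h] at h1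
      exact lt_irrefl _ h1)
  refine this.trans ((mul_le_mul_of_nonneg_left h2 (Real.exp_pos _).le).trans ?_)
  rw [← Real.exp_add]
  apply Real.exp_le_exp.2
  apply le_of_eq
  field_simp
  ring

lemma jl {m d : ℕ} (hm : m ≠ 0) (v : EuclideanSpace ℝ (Fin d)) (τ : ℝ)
    (h0 : 0 ≤ τ) (hτ : τ ≤ 1) :
    (gm m d).real {ω | ¬ |‖Matrix.toEuclideanLin (Matrix.of ω) v‖ ^ 2 - ‖v‖ ^ 2| ≤ τ * ‖v‖ ^ 2}
      ≤ 2 * Real.exp (- (m * τ ^ 2 / 16)) := by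
  rcases eq_or_ne v 0 with rfl | hv
  · simp
    positivity
  have h1 := upper_tail hm v hv (τ / 8) τ (by linarith) (by linarith)
  have h2 := lower_tail hm v hv (τ / 8) τ (by linarith) (by linarith)
  have e : (m:ℝ) * (4 * (τ / 8) ^ 2 - τ / 8 * τ) = - (m * τ ^ 2 / 16) := by ring
  rw [e] at h1 h2
  refine (measureReal_mono ?_).trans ((measureReal_union_le _ _).trans ((add_le_add h1 h2).trans (by linarith)))
  intro ω hω
  simp only [Set.mem_ofPred_eq, not_le, lt_abs, Set.mem_union] at hω ⊢
  rcases hω with h | h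
  · left; linarith
  · right; linarith

lemma sum_words_succ {n k : ℕ} (F : (Fin (k + 1) → Fin n) → ℝ) :
    ∑ w, F w = ∑ i, ∑ w : Fin k → Fin n, F (Fin.cons i w) := by
  rw [← (Fin.consEquiv (fun _ : Fin (k + 1) => Fin n)).sum_comp, Fintype.sum_prod_type]
  rfl

lemma words_moments {E : Type*} [NormedAddCommGroup E] [InnerProductSpace ℝ E] {n : ℕ}
    (l : Fin n → ℝ) (hl : ∑ i, l i = 1) (y : Fin n → E) (k : ℕ) :
    (∑ w : Fin k → Fin n, ∏ j, l (w j) = 1) ∧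
    (∀ z : E, ∑ w : Fin k → Fin n, (∏ j, l (w j)) * inner ℝ z (∑ j, y (w j))
      = k * inner ℝ z (∑ i, l i • y i)) ∧
    (∑ w : Fin k → Fin n, (∏ j, l (w j)) * ‖∑ j, y (w j)‖ ^ 2
      = k * (k - 1) * ‖∑ i, l i • y i‖ ^ 2 + k * ∑ i, l i * ‖y i‖ ^ 2) := by
  induction k with
  | zero => simp
  | succ k ih =>
    obtain ⟨h1, h2, h3⟩ := ih
    have hz : ∀ z : E, ∑ i, l i * inner ℝ z (y i) = inner ℝ z (∑ i, l i • y i) := by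
      intro z
      rw [inner_sum]
      simp [inner_smul_right]
    refine ⟨?_, ?_, ?_⟩
    · rw [sum_words_succ]
      simp only [Fin.prod_univ_succ, Fin.cons_zero, Fin.cons_succ]
      simp_rw [← Finset.mul_sum, h1, mul_one, hl]
    · intro z
      rw [sum_words_succ]
      simp only [Fin.prod_univ_succ, Fin.sum_univ_succ, Fin.cons_zero, Fin.cons_succ, inner_add_right]
      have : ∀ i, ∑ w : Fin k → Fin n, (l i * ∏ j, l (w j)) * (inner ℝ z (y i) + inner ℝ z (∑ j, y (w j)))
          = l i * inner ℝ z (y i) + l i * (k * inner ℝ z (∑ i, l i • y i)) := by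
        intro i
        rw [← h2 z, ← mul_one (l i * inner ℝ z (y i)), ← h1, Finset.mul_sum, Finset.mul_sum,
          ← Finset.sum_add_distrib]
        exact Finset.sum_congr rfl fun w _ => by ring
      simp_rw [this]
      rw [Finset.sum_add_distrib, ← Finset.sum_mul, hl, hz]
      push_cast; ring
    · rw [sum_words_succ]
      simp only [Fin.prod_univ_succ, Fin.sum_univ_succ, Fin.cons_zero, Fin.cons_succ]
      have : ∀ i, ∑ w : Fin k → Fin n, (l i * ∏ j, l (w j)) * ‖y i + ∑ j, y (w j)‖ ^ 2
          = l i * ‖y i‖ ^ 2 + 2 * k * (l i * inner ℝ (∑ i, l i • y i) (y i))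
            + l i * (k * (k - 1) * ‖∑ i, l i • y i‖ ^ 2 + k * ∑ i, l i * ‖y i‖ ^ 2) := by
        intro i
        have e : 2 * k * (l i * inner ℝ (∑ i, l i • y i) (y i))
          = 2 * l i * (k * inner ℝ (y i) (∑ i, l i • y i)) := by
          rw [real_inner_comm]; ring
        rw [e, ← h3, ← h2 (y i), ← mul_one (l i * ‖y i‖ ^ 2), ← h1, Finset.mul_sum, Finset.mul_sum,
          Finset.mul_sum, ← Finset.sum_add_distrib, ← Finset.sum_add_distrib]
        refine Finset.sum_congr rfl fun w _ => ?_
        rw [norm_add_sq_real]; ring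
      simp_rw [this]
      rw [Finset.sum_add_distrib, Finset.sum_add_distrib, ← Finset.sum_mul, hl, ← Finset.mul_sum, hz,
        real_inner_self_eq_norm_sq]
      push_cast; ring

lemma real_final (a r ε : ℝ) (h0 : 0 < ε) (ha : 0 ≤ a) (hr : 0 ≤ r)
    (h : |a ^ 2 - r ^ 2| ≤ 7 * ε * max r ε) : |a - r| ≤ 7 * ε := by
  obtain ⟨q1, q2⟩ := abs_le.1 h
  rcases le_total ε r with h | h
  · rw [max_eq_left h] at q1 q2
    rw [abs_le]
    constructor
    · by_contra hc
      have : 7 * ε < r - a := by linarith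
      nlinarith
    · by_contra hc
      have : 7 * ε < a - r := by linarith
      nlinarith
  · rw [max_eq_right h] at q1 q2
    rw [abs_le]
    constructor
    · linarith
    · by_contra hc
      have : 7 * ε < a := by linarith
      nlinarith

set_option maxHeartbeats 800000 in
lemma det_bound {E F : Type*} [NormedAddCommGroup E] [InnerProductSpace ℝ E]
    [NormedAddCommGroup F] [InnerProductSpace ℝ F] {n : ℕ} (x : Fin n → E) (hx : ∀ i, ‖x i‖ = 1)
    (M : E →ₗ[ℝ] F) (ε : ℝ) (h0 : 0 < ε) (h1 : ε < 1)
    (H : ∀ k : ℕ, 1 ≤ k → k * ε ^ 2 ≤ 2 → ∀ w : Fin k → Fin n,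
      |‖M (∑ j, x (w j))‖ ^ 2 - ‖∑ j, x (w j)‖ ^ 2| ≤ ε * √k * ‖∑ j, x (w j)‖ ^ 2)
    (t : E) (ht : t ∈ convexHull ℝ (Set.range x)) : |‖M t‖ - ‖t‖| ≤ 7 * ε := by
  obtain ⟨l, hl0, hl, rfl⟩ : ∃ l : Fin n → ℝ, (∀ i, 0 ≤ l i) ∧ ∑ i, l i = 1 ∧ ∑ i, l i • x i = t := by
    rw [convexHull_range_eq_exists_affineCombination] at ht
    obtain ⟨s, w, hw0, hw1, rfl⟩ := ht
    refine ⟨fun i => if i ∈ s then w i else 0, ?_, ?_, ?_⟩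
    · intro i; dsimp only; split_ifs with h
      · exact hw0 i h
      · exact le_rfl
    · simpa using hw1
    · rw [s.affineCombination_eq_linear_combination _ _ hw1]
      simp [ite_smul]
  set t := ∑ i, l i • x i with ht'
  have htn : ‖t‖ ≤ 1 := by
    calc ‖t‖ ≤ ∑ i, ‖l i • x i‖ := norm_sum_le _ _
      _ = ∑ i, l i := Finset.sum_congr rfl fun i _ => by
        rw [norm_smul, hx, mul_one, Real.norm_of_nonneg (hl0 i)]
      _ = 1 := hl
  -- single vectors
  have hx1 : ∀ i, |‖M (x i)‖ ^ 2 - 1| ≤ ε := by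
    intro i
    have := H 1 le_rfl (by push_cast; nlinarith) (fun _ => i)
    simpa [hx] using this
  set Q := ‖M t‖ ^ 2 - ‖t‖ ^ 2 with hQ
  set R := ∑ i, l i * ‖M (x i)‖ ^ 2 - 1 with hR
  have hRb : |R| ≤ ε := by
    have : R = ∑ i, l i * (‖M (x i)‖ ^ 2 - 1) := by
      simp_rw [mul_sub, mul_one, Finset.sum_sub_distrib, hl]; rfl
    rw [this]
    calc _ ≤ ∑ i, |l i * (‖M (x i)‖ ^ 2 - 1)| := Finset.abs_sum_le_sum_abs _ _
      _ ≤ ∑ i, l i * ε := Finset.sum_le_sum fun i _ => by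
        rw [abs_mul, abs_of_nonneg (hl0 i)]
        exact mul_le_mul_of_nonneg_left (hx1 i) (hl0 i)
      _ = ε := by rw [← Finset.sum_mul, hl, one_mul]
  have key : ∀ k : ℕ, 1 ≤ k → k * ε ^ 2 ≤ 2 →
      |k * (k - 1) * Q + k * R| ≤ ε * √k * (k * (k - 1) * ‖t‖ ^ 2 + k) := by
    intro k hk hk2
    have a1 := (words_moments l hl x k).2.2
    have a2 := (words_moments l hl (fun i => M (x i)) k).2.2
    simp only [hx, one_pow, mul_one, hl] at a1
    have e1 : ∑ i, l i • M (x i) = M t := by simp [ht']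
    rw [e1] at a2
    rw [← ht'] at a1
    have e2 : k * (k - 1) * Q + k * R = ∑ w : Fin k → Fin n, (∏ j, l (w j)) *
        (‖M (∑ j, x (w j))‖ ^ 2 - ‖∑ j, x (w j)‖ ^ 2) := by
      simp_rw [mul_sub, Finset.sum_sub_distrib, map_sum]
      rw [a1, a2, hQ, hR]; ring
    rw [e2, ← a1, Finset.mul_sum]
    refine (Finset.abs_sum_le_sum_abs _ _).trans (Finset.sum_le_sum fun w _ => ?_)
    have hp : 0 ≤ ∏ j, l (w j) := Finset.prod_nonneg fun j _ => hl0 _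
    rw [abs_mul, abs_of_nonneg hp]
    calc _ ≤ (∏ j, l (w j)) * (ε * √k * ‖∑ j, x (w j)‖ ^ 2) :=
          mul_le_mul_of_nonneg_left (H k hk hk2 w) hp
      _ = _ := by ring
  -- choice of the sparsity
  set ρ := max ‖t‖ ε with hρ
  have hρt : ‖t‖ ≤ ρ := le_max_left _ _
  have hρε : ε ≤ ρ := le_max_right _ _
  have hρ0 : 0 < ρ := h0.trans_le hρε
  have hρ1 : ρ ≤ 1 := max_le htn h1.le
  have hinv : 1 ≤ 1 / ρ ^ 2 := by
    rw [le_div_iff₀ (by positivity)]; nlinarith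
  obtain ⟨k, hk2, hkl, hku⟩ : ∃ k : ℕ, 2 ≤ k ∧ 1 / ρ ^ 2 ≤ k ∧ (k:ℝ) ≤ 2 / ρ ^ 2 := by
    refine ⟨⌊1 / ρ ^ 2⌋₊ + 1, ?_, ?_, ?_⟩
    · have : 1 ≤ ⌊1 / ρ ^ 2⌋₊ := Nat.le_floor (by exact_mod_cast hinv)
      omega
    · push_cast; exact (Nat.lt_floor_add_one _).le
    · push_cast
      have := Nat.floor_le (zero_le_one.trans hinv)
      have e : 2 / ρ ^ 2 = 1 / ρ ^ 2 + 1 / ρ ^ 2 := by ring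
      linarith
  rw [div_le_iff₀ (by positivity)] at hkl
  rw [le_div_iff₀ (by positivity)] at hku
  have hk2' : (2:ℝ) ≤ k := by exact_mod_cast hk2
  have hkey := key k (by omega) (by
    have : ε ^ 2 ≤ ρ ^ 2 := by nlinarith
    nlinarith)
  -- bound on Q
  set s := √(k:ℝ) with hs
  have hs0 : 0 < s := Real.sqrt_pos.2 (by linarith)
  have hss : (k:ℝ) = s ^ 2 := (Real.sq_sqrt (by linarith)).symm
  have hsρ1 : 1 ≤ s * ρ := by
    rw [hss] at hkl
    nlinarith [mul_pos hs0 hρ0]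
  have hsρ2 : s * ρ ≤ 3 / 2 := by
    rw [hss] at hku
    nlinarith [mul_pos hs0 hρ0]
  have hQ1 : s ^ 2 / 2 * |Q| ≤ ε + ε * s * ((s ^ 2) * ‖t‖ ^ 2 + 1) := by
    rw [hss] at hkey hk2'
    have e1 : s ^ 2 * (s ^ 2 - 1) * Q + s ^ 2 * R = s ^ 2 * ((s ^ 2 - 1) * Q + R) := by ring
    have e2 : ε * s * (s ^ 2 * (s ^ 2 - 1) * ‖t‖ ^ 2 + s ^ 2)
      = s ^ 2 * (ε * s * ((s ^ 2 - 1) * ‖t‖ ^ 2 + 1)) := by ring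
    rw [e1, e2, abs_mul, abs_of_nonneg (sq_nonneg s)] at hkey
    have hk3 := le_of_mul_le_mul_left hkey (by positivity)
    have hk4 : (s ^ 2 - 1) * |Q| ≤ |(s ^ 2 - 1) * Q + R| + |R| := by
      have : |(s ^ 2 - 1) * Q| = (s ^ 2 - 1) * |Q| := by
        rw [abs_mul, abs_of_nonneg (by linarith)]
      rw [← this]
      have := abs_sub ((s ^ 2 - 1) * Q + R) R
      simpa using this
    have hk5 : ε * s * ((s ^ 2 - 1) * ‖t‖ ^ 2 + 1) ≤ ε * s * ((s ^ 2) * ‖t‖ ^ 2 + 1) := by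
      apply mul_le_mul_of_nonneg_left _ (by positivity)
      nlinarith [sq_nonneg ‖t‖]
    have hk6 : s ^ 2 / 2 * |Q| ≤ (s ^ 2 - 1) * |Q| :=
      mul_le_mul_of_nonneg_right (by linarith) (abs_nonneg _)
    linarith
  have hQ2 : |Q| ≤ 7 * ε * ρ := by
    have hs43 : 4 / 3 ≤ s := by
      rw [hss] at hk2'
      nlinarith
    have hts : s ^ 2 * ‖t‖ ^ 2 ≤ (s * ρ) ^ 2 := by
      rw [mul_pow]
      exact mul_le_mul_of_nonneg_left (by gcongr) (by positivity)
    have hu : 7 / 4 + (s * ρ) ^ 2 ≤ 7 / 2 * (s * ρ) := by nlinarith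
    have hfin : s ^ 2 / 2 * |Q| ≤ s ^ 2 / 2 * (7 * ε * ρ) := by
      refine hQ1.trans ?_
      have e : s ^ 2 / 2 * (7 * ε * ρ) = ε * s * (7 / 2 * (s * ρ)) := by ring
      have hεs : 0 < ε * s := by positivity
      have a1 : ε ≤ ε * s * (3 / 4) := by nlinarith
      have a2 : ε * s * ((s ^ 2) * ‖t‖ ^ 2 + 1) ≤ ε * s * ((s * ρ) ^ 2 + 1) :=
        mul_le_mul_of_nonneg_left (by linarith) hεs.le
      have a3 := mul_le_mul_of_nonneg_left hu hεs.le
      rw [e]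
      linarith
    exact le_of_mul_le_mul_left hfin (by positivity)
  -- conclusion
  rw [hQ] at hQ2
  have hMt := norm_nonneg (M t)
  have ht0 := norm_nonneg t
  exact real_final _ _ _ h0 hMt ht0 hQ2

lemma compl_bound {m d : ℕ} (S : Set (Fin m → Fin d → ℝ)) (p : ℝ)
    (h : (gm m d).real Sᶜ ≤ p) : ENNReal.ofReal (1 - p) ≤ gm m d S := by
  have h1 : (gm m d).real Set.univ ≤ (gm m d).real S + (gm m d).real Sᶜ := by
    rw [← Set.union_compl_self S]; exact measureReal_union_le _ _
  rw [probReal_univ] at h1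
  rw [ENNReal.ofReal_le_iff_le_toReal (measure_ne_top _ _)]
  change _ ≤ (gm m d).real S
  linarith

lemma main_case {d n m : ℕ} (hn : 1 ≤ n) (ε δ : ℝ) (h0 : 0 < ε) (h1 : ε < 1) (hδ0 : 0 < δ)
    (hδ1 : δ < 1) (x : Fin n → EuclideanSpace ℝ (Fin d)) (hx : ∀ i, ‖x i‖ = 1)
    (hm : 128 * ε⁻¹ ^ 2 * Real.log (4 * n / δ) ≤ m) :
    (gm m d).real {ω | ∀ t ∈ convexHull ℝ (Set.range x),
      |‖Matrix.toEuclideanLin (Matrix.of ω) t‖ - ‖t‖| ≤ 7 * ε}ᶜ ≤ δ / n := by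
  have hn' : (1:ℝ) ≤ n := by exact_mod_cast hn
  set p := δ / (4 * n) with hp
  have hp0 : 0 < p := by positivity
  have hpn : p ≤ 1 / 4 := by
    rw [hp, div_le_iff₀ (by positivity)]; linarith
  have hlog : Real.log (4 * n / δ) = - Real.log p := by
    rw [hp, ← Real.log_inv, inv_div]
  have hl0 : 0 < Real.log (4 * n / δ) := by
    rw [hlog]; have := Real.log_neg hp0 (by linarith); linarith
  have hm0 : m ≠ 0 := by
    rintro rfl
    have : 0 < 128 * ε⁻¹ ^ 2 * Real.log (4 * n / δ) := by positivity
    norm_num at hm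
    norm_num at this
    linarith
  have hmε : 128 * Real.log (4 * n / δ) ≤ m * ε ^ 2 := by
    have := mul_le_mul_of_nonneg_right hm (sq_nonneg ε)
    have e : 128 * ε⁻¹ ^ 2 * Real.log (4 * n / δ) * ε ^ 2 = 128 * Real.log (4 * n / δ) := by
      field_simp
    rwa [e] at this
  set K := ⌊2 / ε ^ 2⌋₊ with hK
  let B : (k : ℕ) → (Fin (k + 1) → Fin n) → Set (Fin m → Fin d → ℝ) := fun k w =>
    {ω | ¬ |‖Matrix.toEuclideanLin (Matrix.of ω) (∑ j, x (w j))‖ ^ 2 - ‖∑ j, x (w j)‖ ^ 2|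
      ≤ (ε * √((k + 1 : ℕ) : ℝ) / 2) * ‖∑ j, x (w j)‖ ^ 2}
  have hsub : {ω | ∀ t ∈ convexHull ℝ (Set.range x),
      |‖Matrix.toEuclideanLin (Matrix.of ω) t‖ - ‖t‖| ≤ 7 * ε}ᶜ ⊆
      ⋃ k ∈ Finset.range K, ⋃ w, B k w := by
    intro ω hω
    by_contra hc
    apply hω
    intro t ht
    refine det_bound x hx (Matrix.toEuclideanLin (Matrix.of ω)) ε h0 h1 ?_ t ht
    intro k hk hk2 w
    obtain ⟨k, rfl⟩ : ∃ q, k = q + 1 := ⟨k - 1, by omega⟩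
    have hkK : k + 1 ≤ K := Nat.le_floor (by rw [le_div_iff₀ (by positivity)]; exact hk2)
    have hnot : ω ∉ B k w := by
      intro h
      apply hc
      simp only [Set.mem_iUnion, Finset.mem_range]
      exact ⟨k, by omega, w, h⟩
    have h2 := not_not.1 hnot
    refine h2.trans ?_
    apply mul_le_mul_of_nonneg_right _ (by positivity)
    have : 0 ≤ ε * √((k + 1 : ℕ) : ℝ) := by positivity
    linarith
  have hB : ∀ k ∈ Finset.range K, ∀ w, (gm m d).real (B k w) ≤ 2 * (p ^ 2) ^ (k + 1) := by
    intro k hk w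
    have hkK : k + 1 ≤ K := by simpa using hk
    have hk2 : ((k + 1 : ℕ) : ℝ) * ε ^ 2 ≤ 2 := by
      rw [← le_div_iff₀ (by positivity)]
      exact (Nat.cast_le.2 hkK).trans (Nat.floor_le (by positivity))
    have hsq : (ε * √((k + 1 : ℕ) : ℝ) / 2) ^ 2 = ((k + 1 : ℕ) : ℝ) * ε ^ 2 / 4 := by
      rw [div_pow, mul_pow, Real.sq_sqrt (by positivity)]; ring
    have hnn : 0 ≤ ε * √((k + 1 : ℕ) : ℝ) / 2 := by positivity
    refine (jl hm0 _ _ hnn (by nlinarith)).trans ?_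
    rw [hsq]
    apply mul_le_mul_of_nonneg_left _ (by norm_num)
    have e : (p ^ 2) ^ (k + 1) = Real.exp (((k + 1 : ℕ) : ℝ) * (2 * Real.log p)) := by
      rw [Real.exp_nat_mul, two_mul, Real.exp_add, Real.exp_log hp0, sq]
    rw [e]
    apply Real.exp_le_exp.2
    rw [hlog] at hmε
    have hk0 : (0:ℝ) ≤ ((k + 1 : ℕ) : ℝ) := by positivity
    have := mul_le_mul_of_nonneg_left hmε hk0
    linarith
  have hpn2 : n * p ^ 2 ≤ p := by
    have : n * p = δ / 4 := by rw [hp]; field_simp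
    have e : n * p ^ 2 = (n * p) * p := by ring
    rw [e, this]; nlinarith
  calc _ ≤ (gm m d).real (⋃ k ∈ Finset.range K, ⋃ w, B k w) := measureReal_mono hsub (measure_ne_top _ _)
    _ ≤ ∑ k ∈ Finset.range K, (gm m d).real (⋃ w, B k w) := measureReal_biUnion_finset_le _ _
    _ ≤ ∑ k ∈ Finset.range K, (2 * p) * (1 / 2) ^ k := by
        refine Finset.sum_le_sum fun k hk => ?_
        calc _ ≤ ∑ w, (gm m d).real (B k w) := measureReal_iUnion_fintype_le _
          _ ≤ ∑ w : Fin (k + 1) → Fin n, 2 * (p ^ 2) ^ (k + 1) :=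
            Finset.sum_le_sum fun w _ => hB k hk w
          _ = 2 * (n * p ^ 2) ^ (k + 1) := by
            simp; ring
          _ ≤ 2 * p ^ (k + 1) := by gcongr
          _ = 2 * p * p ^ k := by ring
          _ ≤ _ := by
            gcongr
            linarith
    _ = 2 * p * ∑ k ∈ Finset.range K, (1 / 2) ^ k := by rw [Finset.mul_sum]
    _ ≤ 2 * p * 2 := by
        gcongr
        exact sum_geometric_two_le K
    _ = δ / n := by rw [hp]; field_simp; norm_num

lemma small_case {d m : ℕ} (ε δ : ℝ) (h0 : 1 / 2 ≤ ε) (hδ0 : 1 / 2 ≤ δ)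
    (x : Fin 1 → EuclideanSpace ℝ (Fin d)) (hx : ∀ i, ‖x i‖ = 1) :
    (gm m d).real {ω | ∀ t ∈ convexHull ℝ (Set.range x),
      |‖Matrix.toEuclideanLin (Matrix.of ω) t‖ - ‖t‖| ≤ 7 * ε}ᶜ ≤ δ := by
  have hx0 := hx 0
  have hr : convexHull ℝ (Set.range x) = {x 0} := by
    rw [Set.range_unique, convexHull_singleton]; rfl
  rw [hr]
  simp only [Set.mem_singleton_iff, forall_eq, hx0]
  rcases Nat.eq_zero_or_pos m with rfl | hm
  · have : {ω : Fin 0 → Fin d → ℝ | |‖Matrix.toEuclideanLin (Matrix.of ω) (x 0)‖ - 1| ≤ 7 * ε}ᶜ = ∅ := by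
      rw [Set.compl_empty_iff, Set.eq_univ_iff_forall]
      intro ω
      have : Matrix.toEuclideanLin (Matrix.of ω) (x 0) = 0 := Subsingleton.elim _ _
      simp only [Set.mem_ofPred_eq, this, norm_zero]
      norm_num
      linarith
    rw [this]; simp; linarith
  · have hu := upper_tail hm.ne' (x 0) (by intro h; simp [h] at hx0) (1 / 4) 8 (by norm_num) le_rfl
    have hm' : (1:ℝ) ≤ m := by exact_mod_cast hm
    refine (measureReal_mono ?_).trans (hu.trans ?_)
    · intro ω hω
      simp only [Set.mem_compl_iff, Set.mem_ofPred_eq, not_le, lt_abs, hx0] at hω ⊢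
      have := norm_nonneg (Matrix.toEuclideanLin (Matrix.of ω) (x 0))
      rcases hω with h | h
      · nlinarith
      · linarith
    · have : Real.exp (m * (4 * (1 / 4) ^ 2 - 1 / 4 * 8)) ≤ Real.exp (-1) :=
        Real.exp_le_exp.2 (by linarith)
      have h2 := Real.exp_neg_one_lt_half
      linarith

lemma log_compare {n : ℕ} (hn : 1 ≤ n) (ε δ : ℝ) (h0 : 0 < ε) (h1 : ε < 1) (hδ0 : 0 < δ)
    (hδ1 : δ < 1) (h : ε < 1 / 2 ∨ 2 ≤ n / δ) :
    1 / 10 * Real.log (4 * n / δ) ≤ Real.log (n * Real.log (2 / ε) / δ) := by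
  have hn' : (1:ℝ) ≤ n := by exact_mod_cast hn
  set N := n / δ with hN
  have hN1 : 1 ≤ N := by rw [hN, le_div_iff₀ hδ0]; linarith
  have l2 := Real.log_two_gt_d9
  have l2' := Real.log_two_lt_d9
  have hl : 0.69 ≤ Real.log (2 / ε) := by
    have : Real.log 2 ≤ Real.log (2 / ε) := by
      apply Real.log_le_log (by norm_num)
      rw [le_div_iff₀ h0]; linarith
    linarith
  have e1 : 4 * n / δ = 4 * N := by rw [hN]; ring
  have e2 : n * Real.log (2 / ε) / δ = N * Real.log (2 / ε) := by rw [hN]; ring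
  have l4 : Real.log 4 = 2 * Real.log 2 := by
    rw [show (4:ℝ) = 2 ^ 2 by norm_num, Real.log_pow]; norm_num
  rw [e1, e2, Real.log_mul (by norm_num) (by linarith), Real.log_mul (by linarith) (by linarith), l4]
  have hNl : 0 ≤ Real.log N := Real.log_nonneg hN1
  rcases h with h | h
  · have h4 : 1.38 ≤ Real.log (2 / ε) := by
      have : Real.log 4 ≤ Real.log (2 / ε) := by
        apply Real.log_le_log (by norm_num)
        rw [le_div_iff₀ h0]; linarith
      linarith
    have h5 : Real.log 1.38 ≤ Real.log (Real.log (2 / ε)) := Real.log_le_log (by norm_num) h4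
    have h6 := Real.one_sub_inv_le_log_of_pos (show (0:ℝ) < 1.38 by norm_num)
    norm_num at h5 h6 
    linarith
  · have h4 : Real.log 2 ≤ Real.log N := Real.log_le_log (by norm_num) h
    have h5 : Real.log 0.69 ≤ Real.log (Real.log (2 / ε)) := Real.log_le_log (by norm_num) hl
    have h6 := Real.one_sub_inv_le_log_of_pos (show (0:ℝ) < 0.69 by norm_num)
    norm_num at h5 h6 
    linarith

/-- **Theorem (MainIdea, second part).** There are universal constants `c, C > 0` so that for
`m ≥ c·ε⁻²·log(n·log(2/ε)/δ)` and `Π` a random `m × d` matrix with i.i.d. `N(0, 1/m)`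
entries, with probability at least `1 - δ/n` every `t ∈ conv{x₁,…,xₙ}` satisfies
`|‖Πt‖ - ‖t‖| ≤ C·ε`. -/
theorem gaussian_matrix_convex_hull_bound :
    ∃ c C : ℝ, 0 < c ∧ 0 < C ∧
      ∀ (d n : ℕ) (ε δ : ℝ), 0 < ε → ε < 1 → 0 < δ → δ < 1 →
        ∀ x : Fin n → EuclideanSpace ℝ (Fin d), (∀ i, ‖x i‖ = 1) →
          ∀ m : ℕ, c * ε⁻¹ ^ 2 * Real.log (n * Real.log (2 / ε) / δ) ≤ (m : ℝ) →
            ENNReal.ofReal (1 - δ / n) ≤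
              (Measure.pi fun _ : Fin m => Measure.pi fun _ : Fin d =>
                  gaussianReal 0 (1 / m : ℝ≥0))
                {ω | ∀ t ∈ convexHull ℝ (Set.range x),
                    |‖Matrix.toEuclideanLin (Matrix.of ω) t‖ - ‖t‖| ≤ C * ε} := by
  refine ⟨1280, 7, by norm_num, by norm_num, ?_⟩
  intro d n ε δ h0 h1 hδ0 hδ1 x hx m hm
  apply compl_bound
  rcases Nat.eq_zero_or_pos n with rfl | hn
  · have : {ω : Fin m → Fin d → ℝ | ∀ t ∈ convexHull ℝ (Set.range x),
        |‖Matrix.toEuclideanLin (Matrix.of ω) t‖ - ‖t‖| ≤ 7 * ε}ᶜ = ∅ := by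
      rw [Set.compl_empty_iff, Set.eq_univ_iff_forall]
      intro ω t ht
      simp at ht
    rw [this]; simp
  by_cases h : ε < 1 / 2 ∨ 2 ≤ n / δ
  · apply main_case hn ε δ h0 h1 hδ0 hδ1 x hx
    refine le_trans ?_ hm
    have hc := log_compare hn ε δ h0 h1 hδ0 hδ1 h
    have h2 := mul_le_mul_of_nonneg_left hc (show 0 ≤ 1280 * ε⁻¹ ^ 2 by positivity)
    linarith
  · simp only [not_or, not_lt, not_le] at h
    obtain ⟨ha, hb⟩ := h
    rw [div_lt_iff₀ hδ0] at hb
    have hn1 : n = 1 := by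
      have : (n:ℝ) < 2 := by linarith
      have : n < 2 := by exact_mod_cast this
      omega
    subst hn1
    have := small_case (m := m) ε δ ha (by push_cast at hb; linarith) x hx
    simpa using this
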